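/- The second moment of traces of Frobenius of Legendre elliptic curves satisfies Σ_{λ ∈ F_p \ {0,1,−1}} a_p(λ)² = p² + o(p²) as p → ∞; precisely, for every ε > 0 there exists N such that for every prime p > N, |Σ_{λ ∈ F_p \ {0,1,−1}} a_p(λ)² − p²| < ε·p², where a_p(λ) := −Σ_{x ∈ F_p} φ(x(x−1)(x−λ)). -/

import Mathlib

open Finset

open scoped Classical in
/-- The quadratic character of `F_p`, with `φ(0) = 0`. -/
noncomputable def phi (p : ℕ) (a : ZMod p) : ℤ :=
  if a = 0 then 0 else if IsSquare a then 1 else -1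

/-- The trace of Frobenius of the Legendre elliptic curve `y² = x(x−1)(x−λ)`:
`a_p(λ) = −Σ_{x ∈ F_p} φ(x(x−1)(x−λ))`. -/
noncomputable def ap (p : ℕ) [NeZero p] (l : ZMod p) : ℤ :=
  -∑ x : ZMod p, phi p (x * (x - 1) * (x - l))

section QuadraticCharacterSums

variable {F : Type*} [Field F] [Fintype F] [DecidableEq F]

theorem sum_quadraticChar_mul_shift (hF : ringChar F ≠ 2) {c : F} (hc : c ≠ 0) :
    ∑ t : F, quadraticChar F (t * (t + c)) = -1 := by
  have hterm (t : F) : quadraticChar F (t * (t + c)) =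
      quadraticChar F (1 + c * t⁻¹) - if t = 0 then 1 else 0 := by
    by_cases ht : t = 0
    · simp [ht]
    · have : t * (t + c) = t ^ 2 * (1 + c * t⁻¹) := by field_simp
      rw [this, map_mul, quadraticChar_sq_one' ht]
      simp [ht]
  let e : F ≃ F :=
    (Equiv.inv F).trans ((Equiv.mulLeft₀ c hc).trans (Equiv.addLeft 1))
  have he : ∑ t : F, quadraticChar F (1 + c * t⁻¹) = 0 := by
    rw [← quadraticChar_sum_zero hF]
    exact Equiv.sum_comp e (fun s => quadraticChar F s)
  simp only [hterm, Finset.sum_sub_distrib, he]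
  simp

theorem sum_quadraticChar_sub_mul_sub (hF : ringChar F ≠ 2) (a b : F) :
    ∑ t : F, quadraticChar F (a - t) * quadraticChar F (b - t) =
      (if a = b then (Fintype.card F : ℤ) else 0) - 1 := by
  have hshift : ∑ t : F, quadraticChar F (a - t) * quadraticChar F (b - t) =
      ∑ t : F, quadraticChar F t * quadraticChar F (t + (b - a)) := by
    rw [← Equiv.sum_comp (Equiv.subLeft a)]
    refine Finset.sum_congr rfl fun t _ => ?_
    simp only [Equiv.subLeft_apply]
    congr 2 <;> ring
  rw [hshift]
  by_cases hab : a = b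
  · have hterm (t : F) : quadraticChar F t * quadraticChar F (t + (b - a)) =
        1 - if t = 0 then 1 else 0 := by
      by_cases ht : t = 0
      · simp [ht]
      · rw [hab, sub_self, add_zero, ← sq, quadraticChar_sq_one ht, if_neg ht,
        sub_zero]
    simp only [hterm, Finset.sum_sub_distrib]
    simp [hab]
  · simp only [← map_mul]
    rw [sum_quadraticChar_mul_shift hF (sub_ne_zero.2 (Ne.symm hab))]
    simp [hab]

/-- Second moment over `t` of the character sum `∑ x, f x χ(g x - t)`. -/
theorem sum_sq_sum_mul_quadraticChar_sub (hF : ringChar F ≠ 2) (f : F → ℤ) (g : F → F) :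
    ∑ t : F, (∑ x : F, f x * quadraticChar F (g x - t)) ^ 2 =
      Fintype.card F * (∑ x : F, ∑ y : F, if g x = g y then f x * f y else 0) -
        (∑ x : F, f x) ^ 2 := by
  calc ∑ t : F, (∑ x : F, f x * quadraticChar F (g x - t)) ^ 2
      = ∑ t : F, ∑ x : F, ∑ y : F,
          f x * f y * (quadraticChar F (g x - t) * quadraticChar F (g y - t)) := by
        refine Finset.sum_congr rfl fun t _ => ?_
        rw [sq, Finset.sum_mul_sum]
        refine Finset.sum_congr rfl fun x _ => Finset.sum_congr rfl fun y _ => ?_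
        ring
    _ = ∑ x : F, ∑ y : F, f x * f y *
          ∑ t : F, quadraticChar F (g x - t) * quadraticChar F (g y - t) := by
        rw [Finset.sum_comm]
        refine Finset.sum_congr rfl fun x _ => ?_
        rw [Finset.sum_comm]
        simp only [Finset.mul_sum]
    _ = _ := by
        simp only [sum_quadraticChar_sub_mul_sub hF]
        rw [sq, Finset.sum_mul_sum, Finset.mul_sum, ← Finset.sum_sub_distrib]
        refine Finset.sum_congr rfl fun x _ => ?_
        rw [Finset.mul_sum, ← Finset.sum_sub_distrib]
        refine Finset.sum_congr rfl fun y _ => ?_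
        split_ifs <;> ring

theorem sum_sq_legendre (hF : ringChar F ≠ 2) :
    ∑ t : F, (∑ x : F, quadraticChar F (x * (x - 1) * (x - t))) ^ 2 =
      (Fintype.card F : ℤ) * (Fintype.card F - 2) - 1 := by
  have h := sum_sq_sum_mul_quadraticChar_sub hF
    (fun x : F => quadraticChar F (x * (x - 1))) id
  have hsum : ∑ x : F, quadraticChar F (x * (x - 1)) = -1 := by
    simpa [sub_eq_add_neg] using sum_quadraticChar_mul_shift hF (c := (-1 : F)) (by simp)
  have hterm (x : F) : quadraticChar F (x * (x - 1)) * quadraticChar F (x * (x - 1)) =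
      1 - (if x = 0 then 1 else 0) - if x = 1 then 1 else 0 := by
    by_cases h0 : x = 0
    · simp [h0]
    by_cases h1 : x = 1
    · simp [h1]
    · rw [← sq, quadraticChar_sq_one (mul_ne_zero h0 (sub_ne_zero.2 h1))]
      simp [h0, h1]
  simp only [id, ← map_mul (quadraticChar F), hsum] at h
  rw [h]
  simp only [Finset.sum_ite_eq, Finset.mem_univ, if_true, map_mul (quadraticChar F)] at hterm ⊢
  simp only [hterm, Finset.sum_sub_distrib]
  simp
  ring

theorem card_filter_sq_eq_sq_le_two (x : F) :
    (Finset.univ.filter fun y : F => x ^ 2 = y ^ 2).card ≤ 2 := by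
  refine (Finset.card_le_card (t := {x, -x}) fun y hy => ?_).trans Finset.card_le_two
  simp only [Finset.mem_filter, Finset.mem_univ, true_and] at hy
  rcases sq_eq_sq_iff_eq_or_eq_neg.1 hy.symm with h | h <;> simp [h]

theorem quadraticChar_mul_le_one (a b : F) : quadraticChar F a * quadraticChar F b ≤ 1 := by
  rw [← map_mul]
  rcases quadraticChar_isQuadratic F (a * b) with h | h | h <;> simp [h]

theorem sum_sq_jacobsthal_le (hF : ringChar F ≠ 2) :
    ∑ t : F, (∑ x : F, quadraticChar F x * quadraticChar F (x ^ 2 - t)) ^ 2 ≤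
      2 * (Fintype.card F : ℤ) ^ 2 := by
  rw [sum_sq_sum_mul_quadraticChar_sub hF (fun x => quadraticChar F x) (· ^ 2)]
  have hinner (x : F) :
      (∑ y : F, if x ^ 2 = y ^ 2 then quadraticChar F x * quadraticChar F y else 0) ≤ 2 := by
    rw [← Finset.sum_filter]
    calc _ ≤ ∑ y : F with x ^ 2 = y ^ 2, (1 : ℤ) :=
          Finset.sum_le_sum fun y _ => quadraticChar_mul_le_one x y
      _ ≤ 2 := by
          rw [Finset.sum_const, nsmul_one]
          exact_mod_cast card_filter_sq_eq_sq_le_two x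
  have hdiag := Finset.sum_le_sum fun (x : F) (_ : x ∈ Finset.univ) => hinner x
  simp only [Finset.sum_const, Finset.card_univ, nsmul_eq_mul] at hdiag
  nlinarith [sq_nonneg (∑ x : F, quadraticChar F x)]

theorem jacobsthal_sq_scale {u : F} (hu : u ≠ 0) :
    (∑ x : F, quadraticChar F x * quadraticChar F (x ^ 2 - u ^ 2)) ^ 2 =
      (∑ x : F, quadraticChar F x * quadraticChar F (x ^ 2 - 1)) ^ 2 := by
  have hscale : ∑ x : F, quadraticChar F x * quadraticChar F (x ^ 2 - u ^ 2) =
      quadraticChar F u * ∑ x : F, quadraticChar F x * quadraticChar F (x ^ 2 - 1) := by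
    rw [← Equiv.sum_comp (Equiv.mulLeft₀ u hu), Finset.mul_sum]
    refine Finset.sum_congr rfl fun x _ => ?_
    have : (u * x) ^ 2 - u ^ 2 = u ^ 2 * (x ^ 2 - 1) := by ring
    simp only [Equiv.mulLeft₀_apply]
    rw [this, map_mul, map_mul, quadraticChar_sq_one' hu]
    ring
  rw [hscale, mul_pow, quadraticChar_sq_one hu, one_mul]

theorem sum_comp_sq_le (h : F → ℤ) (hh : ∀ t, 0 ≤ h t) :
    ∑ u : F, h (u ^ 2) ≤ 2 * ∑ t : F, h t := by
  rw [← Finset.sum_fiberwise' Finset.univ (fun u : F => u ^ 2) h, Finset.mul_sum]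
  refine Finset.sum_le_sum fun t _ => ?_
  rw [Finset.sum_const, nsmul_eq_mul]
  refine mul_le_mul_of_nonneg_right ?_ (hh t)
  by_cases ht : ∃ x : F, x ^ 2 = t
  · obtain ⟨x, rfl⟩ := ht
    simp only [eq_comm (b := x ^ 2)]
    exact_mod_cast card_filter_sq_eq_sq_le_two x
  · rw [Finset.filter_false_of_mem fun u _ hu => ht ⟨u, hu⟩]
    simp

/-- A weak form of the Hasse bound for `y² = x³ - x`. -/
theorem jacobsthal_sq_le (hF : ringChar F ≠ 2) :
    (∑ x : F, quadraticChar F x * quadraticChar F (x ^ 2 - 1)) ^ 2 ≤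
      8 * (Fintype.card F : ℤ) := by
  set S := (∑ x : F, quadraticChar F x * quadraticChar F (x ^ 2 - 1)) ^ 2 with hS
  have hupper := (sum_comp_sq_le
    (fun t : F => (∑ x : F, quadraticChar F x * quadraticChar F (x ^ 2 - t)) ^ 2)
    fun _ => sq_nonneg _).trans (mul_le_mul_of_nonneg_left (sum_sq_jacobsthal_le hF) zero_le_two)
  have hlower : ((Fintype.card F : ℤ) - 1) * S ≤
      ∑ u : F, (∑ x : F, quadraticChar F x * quadraticChar F (x ^ 2 - u ^ 2)) ^ 2 := by
    calc ((Fintype.card F : ℤ) - 1) * S = ∑ u : F, (S - if u = 0 then S else 0) := by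
          simp [Finset.sum_sub_distrib]; ring
      _ ≤ _ := by
          refine Finset.sum_le_sum fun u _ => ?_
          by_cases hu : u = 0
          · simpa [hu] using sq_nonneg _
          · rw [jacobsthal_sq_scale hu, if_neg hu, sub_zero]
  have hcard : (2 : ℤ) ≤ Fintype.card F := by exact_mod_cast Fintype.one_lt_card (α := F)
  have hS0 : 0 ≤ S := sq_nonneg _
  by_contra! hlt
  nlinarith

theorem sum_quadraticChar_legendre_zero (hF : ringChar F ≠ 2) :
    ∑ x : F, quadraticChar F (x * (x - 1) * (x - 0)) = -quadraticChar F (-1) := by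
  have hterm (x : F) : quadraticChar F (x * (x - 1) * (x - 0)) =
      quadraticChar F (x - 1) - if x = 0 then quadraticChar F (-1) else 0 := by
    by_cases hx : x = 0
    · simp [hx]
    · have : x * (x - 1) * (x - 0) = x ^ 2 * (x - 1) := by ring
      rw [this, map_mul, quadraticChar_sq_one' hx]
      simp [hx]
  have hshift : ∑ x : F, quadraticChar F (x - 1) = 0 := by
    rw [← quadraticChar_sum_zero hF]
    exact Equiv.sum_comp (Equiv.subRight (1 : F)) (fun x => quadraticChar F x)
  simp only [hterm, Finset.sum_sub_distrib, hshift]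
  simp

theorem sum_quadraticChar_legendre_one (hF : ringChar F ≠ 2) :
    ∑ x : F, quadraticChar F (x * (x - 1) * (x - 1)) = -1 := by
  have hterm (x : F) : quadraticChar F (x * (x - 1) * (x - 1)) =
      quadraticChar F x - if x = 1 then 1 else 0 := by
    by_cases hx : x = 1
    · simp [hx]
    · rw [mul_assoc, ← sq, map_mul, quadraticChar_sq_one' (sub_ne_zero.2 hx)]
      simp [hx]
  simp only [hterm, Finset.sum_sub_distrib, quadraticChar_sum_zero hF]
  simp

end QuadraticCharacterSums

theorem phi_eq_quadraticChar (p : ℕ) [Fact p.Prime] (a : ZMod p) :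
    phi p a = quadraticChar (ZMod p) a := by
  simp only [phi, quadraticChar_apply, quadraticCharFun]
  congr

theorem ap_eq_neg_sum_quadraticChar (p : ℕ) [Fact p.Prime] (l : ZMod p) :
    ap p l = -∑ x : ZMod p, quadraticChar (ZMod p) (x * (x - 1) * (x - l)) := by
  simp only [ap, phi_eq_quadraticChar]

theorem abs_sum_ap_sq_sub_sq_le (p : ℕ) [Fact p.Prime] (hp : p ≠ 2) :
    |∑ l ∈ Finset.univ.filter (fun l : ZMod p => l ≠ 0 ∧ l ≠ 1 ∧ l ≠ -1), ap p l ^ 2 -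
      (p : ℤ) ^ 2| ≤ 12 * p := by
  have hF : ringChar (ZMod p) ≠ 2 := by rwa [ZMod.ringChar_zmod_n]
  have hall : ∑ l : ZMod p, ap p l ^ 2 = (p : ℤ) * (p - 2) - 1 := by
    simpa [ap_eq_neg_sum_quadraticChar] using sum_sq_legendre hF
  have h0 : ap p 0 ^ 2 = 1 := by
    rw [ap_eq_neg_sum_quadraticChar, sum_quadraticChar_legendre_zero hF, neg_neg]
    exact quadraticChar_sq_one (by simp)
  have h1 : ap p 1 ^ 2 = 1 := by
    rw [ap_eq_neg_sum_quadraticChar, sum_quadraticChar_legendre_one hF]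
    norm_num
  have hneg : ap p (-1) ^ 2 ≤ 8 * p := by
    have hterm (x : ZMod p) : quadraticChar (ZMod p) (x * (x - 1) * (x - -1)) =
        quadraticChar (ZMod p) x * quadraticChar (ZMod p) (x ^ 2 - 1) := by
      rw [← map_mul]
      congr 1
      ring
    have := jacobsthal_sq_le hF
    rw [ZMod.card] at this
    simpa only [ap_eq_neg_sum_quadraticChar, neg_sq, hterm] using this
  have hne : (1 : ZMod p) ≠ -1 := (Ring.neg_one_ne_one_of_char_ne_two hF).symm
  have hcompl : (Finset.univ.filter fun l : ZMod p => ¬(l ≠ 0 ∧ l ≠ 1 ∧ l ≠ -1)) =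
      {0, 1, -1} := by
    ext l
    simp only [Finset.mem_filter, Finset.mem_univ, true_and, Finset.mem_insert,
      Finset.mem_singleton]
    tauto
  have hsplit := Finset.sum_filter_add_sum_filter_not Finset.univ
    (fun l : ZMod p => l ≠ 0 ∧ l ≠ 1 ∧ l ≠ -1) fun l => ap p l ^ 2
  rw [hcompl, Finset.sum_insert (by simp), Finset.sum_insert (by simpa using hne),
    Finset.sum_singleton, hall, h0, h1] at hsplit
  have hpos : (2 : ℤ) ≤ p := by exact_mod_cast (Fact.out : p.Prime).two_le
  rw [abs_le]
  constructor <;> nlinarith [sq_nonneg (ap p (-1))]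

/-- `Σ_{λ ∈ F_p∖{0,±1}} a_p(λ)² = p² + o(p²)` as `p → ∞`. -/
theorem second_moment_trace_asymptotic :
    ∀ ε : ℝ, 0 < ε → ∃ N : ℕ, ∀ p : ℕ, ∀ _hp : p.Prime, ∀ hN : N < p,
      haveI : NeZero p := ⟨by omega⟩
      |((∑ l ∈ Finset.univ.filter (fun l : ZMod p => l ≠ 0 ∧ l ≠ 1 ∧ l ≠ -1),
          (ap p l) ^ 2 : ℤ) : ℝ) - (p : ℝ) ^ 2| < ε * (p : ℝ) ^ 2 := by
  intro ε hε
  obtain ⟨N, hN⟩ := exists_nat_gt (12 / ε)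
  refine ⟨max N 2, fun p hp hlt => ?_⟩
  have : Fact p.Prime := ⟨hp⟩
  have hbound := abs_sum_ap_sq_sub_sq_le p (by omega)
  have hp0 : (0 : ℝ) < p := by exact_mod_cast hp.pos
  have hNp : (N : ℝ) ≤ p := by
    exact_mod_cast (le_max_left N 2).trans hlt.le
  have hε' : 12 < ε * p := by
    rw [div_lt_iff₀ hε] at hN
    nlinarith
  refine lt_of_le_of_lt (b := 12 * (p : ℝ)) (by exact_mod_cast hbound) ?_
  nlinarith
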